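/- Reduction from global mincut to second (s,t)-mincut: Let G be a directed weighted graph on a finite vertex set V with |V| ≥ 2 such that every global cut of G has strictly positive capacity. Let G1 be the directed weighted graph on V ∪ {s1, t1}, where s1, t1 ∉ V are two new vertices, with the same capacities as G on V × V and capacity 0 on all pairs involving s1 or t1. Then: (1) the minimum capacity of an (s1,t1)-cut of G1 is 0, and the only (s1,t1)-cuts of capacity 0 are {s1} and {s1} ∪ V; and (2) for every second (s1,t1)-mincut C of G1, the set C ∖ {s1} is a global mincut of G, and the capacity of C in G1 equals the global mincut capacity of G. -/

import Mathlib

open Finset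

section Defs

variable {V : Type*} [Fintype V] [DecidableEq V]

/-- Capacity of the global cut `A`. -/
def gcap (w : V → V → ℝ) (A : Finset V) : ℝ := ∑ u ∈ A, ∑ v ∈ Aᶜ, w u v

/-- Capacity of an `(s,t)`-cut `C`. -/
def cutCapR (w : V → V → ℝ) (C : Finset V) : ℝ := ∑ u ∈ C, ∑ v ∈ Cᶜ, w u v

/-- `A` is a global mincut. -/
def IsGlobalMincut (w : V → V → ℝ) (A : Finset V) : Prop :=
  A.Nonempty ∧ A ≠ Finset.univ ∧
    ∀ B : Finset V, B.Nonempty → B ≠ Finset.univ → gcap w A ≤ gcap w B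

/-- `C` is a second `(s,t)`-mincut: an `(s,t)`-cut of minimum capacity among all
`(s,t)`-cuts of capacity strictly greater than `lam`. -/
def IsSecondMincut (s t : V) (w : V → V → ℝ) (lam : ℝ) (C : Finset V) : Prop :=
  s ∈ C ∧ t ∉ C ∧ lam < cutCapR w C ∧
    ∀ D : Finset V, s ∈ D → t ∉ D → lam < cutCapR w D → cutCapR w C ≤ cutCapR w D

end Defs

/-- The graph `G1` on `V ∪ {s1, t1}`: same capacities on `V × V`, capacity `0` on all pairs
involving the new vertices `s1 = Sum.inr true` and `t1 = Sum.inr false`. -/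
def extendW {V : Type*} (w : V → V → ℝ) : V ⊕ Bool → V ⊕ Bool → ℝ
  | Sum.inl u, Sum.inl v => w u v
  | _, _ => 0

theorem cutCapR_extendW {V : Type*} [Fintype V] [DecidableEq V] (w : V → V → ℝ)
    (C : Finset (V ⊕ Bool)) :
    cutCapR (extendW w) C = gcap w (Finset.univ.filter fun v : V => Sum.inl v ∈ C) := by
  have sum_eq_ite {α : Type _} [Fintype α] [DecidableEq α] (s : Finset α) (f : α → ℝ) :
      ∑ a ∈ s, f a = ∑ a, if a ∈ s then f a else 0 := by simp
  unfold cutCapR gcap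
  rw [sum_eq_ite C, sum_eq_ite (Finset.univ.filter _), Fintype.sum_sum_type]
  simp only [sum_eq_ite Cᶜ, sum_eq_ite (Finset.univ.filter fun v : V => Sum.inl v ∈ C)ᶜ,
    Fintype.sum_sum_type]
  simp [extendW]

theorem gcap_empty {V : Type*} [Fintype V] [DecidableEq V] (w : V → V → ℝ) :
    gcap w ∅ = 0 := by
  simp [gcap]

theorem gcap_univ {V : Type*} [Fintype V] [DecidableEq V] (w : V → V → ℝ) :
    gcap w Finset.univ = 0 := by
  simp [gcap]

theorem gcap_nonneg {V : Type*} [Fintype V] [DecidableEq V] {w : V → V → ℝ}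
    (hw : ∀ u v, 0 ≤ w u v) (A : Finset V) : 0 ≤ gcap w A :=
  Finset.sum_nonneg fun u _ => Finset.sum_nonneg fun v _ => hw u v

/-- **Reduction from global mincut to second `(s,t)`-mincut.** With `s1 = Sum.inr true` and
`t1 = Sum.inr false`: (1) the `(s1,t1)`-mincut capacity of `G1` is `0`, and the only
`(s1,t1)`-cuts of capacity `0` are `{s1}` and `{s1} ∪ V`; (2) for every second
`(s1,t1)`-mincut `C` of `G1`, the set of vertices of `V` in `C` is a global mincut of `G`,
and the capacity of `C` in `G1` equals the global mincut capacity of `G`. -/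
theorem global_mincut_reduces_to_second_mincut
    {V : Type*} [Fintype V] [DecidableEq V]
    (hcard : 2 ≤ Fintype.card V)
    (w : V → V → ℝ) (hw0 : ∀ u v, 0 ≤ w u v) (hwdiag : ∀ v, w v v = 0)
    (hpos : ∀ A : Finset V, A.Nonempty → A ≠ Finset.univ → 0 < gcap w A) :
    (IsLeast {x : ℝ | ∃ C : Finset (V ⊕ Bool),
        Sum.inr true ∈ C ∧ Sum.inr false ∉ C ∧ cutCapR (extendW w) C = x} 0 ∧
      ∀ C : Finset (V ⊕ Bool), Sum.inr true ∈ C → Sum.inr false ∉ C →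
        cutCapR (extendW w) C = 0 →
        (C = {Sum.inr true} ∨
          C = insert (Sum.inr true) (Finset.univ.image (Sum.inl : V → V ⊕ Bool)))) ∧
    (∀ C : Finset (V ⊕ Bool),
      IsSecondMincut (Sum.inr true) (Sum.inr false) (extendW w) 0 C →
      IsGlobalMincut w (Finset.univ.filter fun v : V => Sum.inl v ∈ C) ∧
      cutCapR (extendW w) C = gcap w (Finset.univ.filter fun v : V => Sum.inl v ∈ C)) := by
  refine ⟨⟨⟨⟨{Sum.inr true}, by simp, by simp, ?_⟩, ?_⟩, ?_⟩, ?_⟩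
  · rw [cutCapR_extendW]
    simp [gcap_empty]
  · rintro x ⟨C, -, -, rfl⟩
    rw [cutCapR_extendW]
    exact gcap_nonneg hw0 _
  · intro C hs ht hC
    rw [cutCapR_extendW] at hC
    by_cases hne : (Finset.univ.filter fun v : V => Sum.inl v ∈ C).Nonempty
    · right
      have huniv : (Finset.univ.filter fun v : V => Sum.inl v ∈ C) = Finset.univ := by
        by_contra h
        exact (hpos _ hne h).ne' hC
      rw [Finset.filter_eq_self] at huniv
      ext (v | (_ | _))
      · simpa using huniv v (Finset.mem_univ v)
      · simpa using ht
      · simpa using hs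
    · left
      rw [Finset.not_nonempty_iff_eq_empty, Finset.filter_eq_empty_iff] at hne
      ext (v | (_ | _))
      · simpa using hne (Finset.mem_univ v)
      · simpa using ht
      · simpa using hs
  · rintro C ⟨-, -, hC, hmin⟩
    rw [cutCapR_extendW] at hC hmin
    refine ⟨⟨?_, ?_, fun B hB hB' => ?_⟩, cutCapR_extendW w C⟩
    · by_contra h
      rw [Finset.not_nonempty_iff_eq_empty.mp h, gcap_empty] at hC
      exact hC.false
    · intro h
      rw [h, gcap_univ] at hC
      exact hC.false
    · have hcap : cutCapR (extendW w) (insert (Sum.inr true) (B.image Sum.inl)) = gcap w B := by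
        rw [cutCapR_extendW]
        congr 1
        ext v
        simp
      rw [← hcap]
      exact hmin _ (by simp) (by simp) (hcap ▸ hpos B hB hB')
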